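/- Let R₁ > 0 and let μ be a Borel probability measure on ℝ^d supported in the closed ball B̄(R₁). Then the map z ↦ γ(z, μ) is twice Fréchet differentiable at every z ∈ ℝ^d, and its second derivative, viewed as a bilinear map, satisfies ‖D²_z γ(z, μ)(u, v)‖ ≤ 8 R₁³ ‖u‖ ‖v‖ for all u, v ∈ ℝ^d. Consequently D_zγ(·, μ) is Lipschitz with constant 8R₁³ with respect to the operator norm. -/

import Mathlib

open MeasureTheory
open scoped RealInnerProductSpace

/-- The normalisation constant `γ₂(z, μ) = ∫ exp⟨z,y⟩ dμ(y)`. -/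
noncomputable def gamma2 {d : ℕ} (z : EuclideanSpace ℝ (Fin d))
    (μ : Measure (EuclideanSpace ℝ (Fin d))) : ℝ :=
  ∫ y, Real.exp ⟪z, y⟫ ∂μ

/-- The attention map `γ(z, μ) = (∫ exp⟨z,y⟩ • y dμ(y)) / γ₂(z, μ)`. -/
noncomputable def gammaAttn {d : ℕ} (z : EuclideanSpace ℝ (Fin d))
    (μ : Measure (EuclideanSpace ℝ (Fin d))) : EuclideanSpace ℝ (Fin d) :=
  (gamma2 z μ)⁻¹ • ∫ y, Real.exp ⟪z, y⟫ • y ∂μ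

/-- Unnormalised exponential integral. -/
noncomputable def expI {d : ℕ} {F : Type} [NormedAddCommGroup F] [NormedSpace ℝ F]
    (μ : Measure (EuclideanSpace ℝ (Fin d))) (φ : EuclideanSpace ℝ (Fin d) → F)
    (z : EuclideanSpace ℝ (Fin d)) : F := ∫ y, Real.exp ⟪z, y⟫ • φ y ∂μ

/-- Normalised exponential average. -/
noncomputable def expA {d : ℕ} {F : Type} [NormedAddCommGroup F] [NormedSpace ℝ F]
    (μ : Measure (EuclideanSpace ℝ (Fin d))) (φ : EuclideanSpace ℝ (Fin d) → F)
    (z : EuclideanSpace ℝ (Fin d)) : F := (gamma2 z μ)⁻¹ • expI μ φ z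

/-- The function appearing in the derivative. -/
noncomputable def dPhi {d : ℕ} {F : Type} [NormedAddCommGroup F] [NormedSpace ℝ F]
    (φ : EuclideanSpace ℝ (Fin d) → F) (y : EuclideanSpace ℝ (Fin d)) :
    EuclideanSpace ℝ (Fin d) →L[ℝ] F := ContinuousLinearMap.smulRightL ℝ _ F (innerSL ℝ y) (φ y)

section helpers

variable {d : ℕ} {F : Type} [NormedAddCommGroup F] [NormedSpace ℝ F]
  {μ : Measure (EuclideanSpace ℝ (Fin d))} [IsProbabilityMeasure μ] {R : ℝ}

theorem continuous_dPhi {φ : EuclideanSpace ℝ (Fin d) → F} (hφ : Continuous φ) :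
    Continuous (dPhi φ) := by
  unfold dPhi
  exact ((ContinuousLinearMap.smulRightL ℝ _ F).continuous.comp
    (innerSL ℝ).continuous).clm_apply hφ

theorem norm_dPhi (φ : EuclideanSpace ℝ (Fin d) → F) (y : EuclideanSpace ℝ (Fin d)) :
    ‖dPhi φ y‖ = ‖y‖ * ‖φ y‖ := by
  have : dPhi φ y = ContinuousLinearMap.smulRight (innerSL ℝ y) (φ y) := rfl
  rw [this, ContinuousLinearMap.norm_smulRight_apply, innerSL_apply_norm]

theorem ae_bound (hμ : ∀ᵐ y ∂μ, ‖y‖ ≤ R) {φ : EuclideanSpace ℝ (Fin d) → F}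
    (hφ : Continuous φ) : ∃ C, ∀ᵐ y ∂μ, ‖φ y‖ ≤ C := by
  obtain ⟨C, hC⟩ := (isCompact_closedBall (0 : EuclideanSpace ℝ (Fin d)) R).exists_bound_of_continuousOn
    hφ.continuousOn
  refine ⟨C, hμ.mono fun y hy => hC y (by simpa using hy)⟩

theorem expIntegrable (hμ : ∀ᵐ y ∂μ, ‖y‖ ≤ R) {φ : EuclideanSpace ℝ (Fin d) → F}
    (hφ : Continuous φ) (z : EuclideanSpace ℝ (Fin d)) :
    Integrable (fun y => Real.exp ⟪z, y⟫ • φ y) μ := by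
  have hc : Continuous (fun y => Real.exp ⟪z, y⟫ • φ y) := by fun_prop
  obtain ⟨C, hC⟩ := ae_bound hμ hc
  exact Integrable.of_bound hc.aestronglyMeasurable C hC

theorem hasFDerivAt_expI (hμ : ∀ᵐ y ∂μ, ‖y‖ ≤ R) {φ : EuclideanSpace ℝ (Fin d) → F}
    (hφ : Continuous φ) (z : EuclideanSpace ℝ (Fin d)) :
    HasFDerivAt (expI μ φ) (expI μ (dPhi φ) z) z := by
  obtain ⟨C, hC⟩ := ae_bound hμ (continuous_dPhi hφ)
  have hcd := continuous_dPhi hφ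
  unfold expI
  refine hasFDerivAt_integral_of_dominated_of_fderiv_le (s := Metric.ball z 1)
    (F' := fun w y => Real.exp ⟪w, y⟫ • dPhi φ y)
    (bound := fun _ => Real.exp ((‖z‖ + 1) * R) * C) (Metric.ball_mem_nhds z one_pos) ?_
    (expIntegrable hμ hφ z) ?_ ?_ (integrable_const _) ?_
  · refine Filter.Eventually.of_forall fun w => ?_
    exact (expIntegrable hμ hφ w).aestronglyMeasurable
  · exact (expIntegrable hμ hcd z).aestronglyMeasurable
  · filter_upwards [hμ, hC] with y hy hCy w hw
    rw [norm_smul, Real.norm_eq_abs, Real.abs_exp]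
    have h1 : ‖w‖ ≤ ‖z‖ + 1 := by
      have := norm_sub_norm_le w z
      rw [Metric.mem_ball, dist_eq_norm] at hw
      linarith
    have h2 : ⟪w, y⟫ ≤ (‖z‖ + 1) * R := (real_inner_le_norm w y).trans (by gcongr)
    gcongr
  · refine Filter.Eventually.of_forall fun y w _ => ?_
    have h1 : HasFDerivAt (fun w : EuclideanSpace ℝ (Fin d) => ⟪w, y⟫) (innerSL ℝ y) w := by
      have := (innerSL ℝ y).hasFDerivAt (x := w)
      refine this.congr_of_eventuallyEq (Filter.Eventually.of_forall fun x => ?_)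
      simp [real_inner_comm]
    have h2 := h1.exp.smul_const (φ y)
    refine h2.congr_fderiv ?_
    ext v
    simp [dPhi, mul_smul]

theorem gamma2_pos (hμ : ∀ᵐ y ∂μ, ‖y‖ ≤ R) (z : EuclideanSpace ℝ (Fin d)) : 0 < gamma2 z μ := by
  unfold gamma2
  refine integral_exp_pos ?_
  simpa using expIntegrable hμ (φ := fun _ => (1 : ℝ)) continuous_const z

theorem gamma2_eq : (fun z => gamma2 z μ) = expI μ (fun _ => (1 : ℝ)) := by
  funext z; simp [gamma2, expI]

theorem norm_expA_le (hμ : ∀ᵐ y ∂μ, ‖y‖ ≤ R) {φ : EuclideanSpace ℝ (Fin d) → F} {C : ℝ}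
    (hC : ∀ᵐ y ∂μ, ‖φ y‖ ≤ C) (z : EuclideanSpace ℝ (Fin d)) :
    ‖expA μ φ z‖ ≤ C := by
  have hp := gamma2_pos hμ z
  unfold expA expI
  rw [norm_smul, norm_inv, Real.norm_of_nonneg hp.le, inv_mul_le_iff₀ hp]
  have hi : Integrable (fun y => Real.exp ⟪z, y⟫) μ := by
    simpa using expIntegrable hμ (φ := fun _ => (1 : ℝ)) continuous_const z
  rw [gamma2, ← integral_mul_const]
  refine norm_integral_le_of_norm_le (hi.mul_const C) ?_
  filter_upwards [hC] with y hy
  rw [norm_smul, Real.norm_eq_abs, Real.abs_exp]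
  gcongr

theorem expA_innerSL (hμ : ∀ᵐ y ∂μ, ‖y‖ ≤ R) (z : EuclideanSpace ℝ (Fin d)) :
    expA μ (fun y => innerSL ℝ y) z = innerSL ℝ (expA μ (fun y => y) z) := by
  unfold expA expI
  have := (innerSL ℝ (E := EuclideanSpace ℝ (Fin d))).integral_comp_comm
    (expIntegrable hμ (φ := fun y => y) continuous_id z)
  rw [ContinuousLinearMap.map_smul_of_tower, ← this]
  simp

theorem hasFDerivAt_expA (hμ : ∀ᵐ y ∂μ, ‖y‖ ≤ R) {φ : EuclideanSpace ℝ (Fin d) → F}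
    (hφ : Continuous φ) (z : EuclideanSpace ℝ (Fin d)) :
    HasFDerivAt (expA μ φ) (expA μ (dPhi φ) z -
      ContinuousLinearMap.smulRightL ℝ _ F (expA μ (fun y => innerSL ℝ y) z) (expA μ φ z)) z := by
  have hp := gamma2_pos hμ z
  have h1 := hasFDerivAt_expI hμ hφ z
  have h2 := hasFDerivAt_expI hμ (φ := fun _ => (1 : ℝ)) continuous_const z
  rw [← gamma2_eq] at h2
  have h3 := ((hasDerivAt_inv hp.ne').comp_hasFDerivAt z h2).smul h1
  have h4 : dPhi (fun _ : EuclideanSpace ℝ (Fin d) => (1 : ℝ)) = fun y => innerSL ℝ y := by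
    funext y; ext v; simp [dPhi]
  rw [h4] at h3
  refine h3.congr_fderiv ?_
  ext v
  simp [expA, smul_smul, sub_eq_add_neg]
  congr 1
  field_simp

end helpers


section second

variable {d : ℕ} {μ : Measure (EuclideanSpace ℝ (Fin d))} [IsProbabilityMeasure μ] {R : ℝ}

theorem gammaAttn_eq (μ : Measure (EuclideanSpace ℝ (Fin d))) :
    (fun w => gammaAttn w μ) = expA μ (fun y => y) := rfl

theorem fderiv_gammaAttn (hμ : ∀ᵐ y ∂μ, ‖y‖ ≤ R) :
    fderiv ℝ (fun w => gammaAttn w μ) = fun z => expA μ (dPhi fun y => y) z -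
      ContinuousLinearMap.smulRightL ℝ _ _ (expA μ (fun y => innerSL ℝ y) z)
        (expA μ (fun y => y) z) := by
  funext z
  rw [gammaAttn_eq]
  exact (hasFDerivAt_expA hμ continuous_id z).fderiv

theorem hasFDerivAt_fderiv_gammaAttn (hμ : ∀ᵐ y ∂μ, ‖y‖ ≤ R) (z : EuclideanSpace ℝ (Fin d)) :
    DifferentiableAt ℝ (fderiv ℝ (fun w => gammaAttn w μ)) z ∧
    (gammaAttn z μ = 0 → fderiv ℝ (fderiv ℝ (fun w => gammaAttn w μ)) z =
      expA μ (dPhi (dPhi fun y => y)) z) := by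
  have h1 := hasFDerivAt_expA hμ (continuous_dPhi (d := d) continuous_id) z
  have h2 := hasFDerivAt_expA hμ (innerSL ℝ (E := EuclideanSpace ℝ (Fin d))).continuous z
  have h3 := hasFDerivAt_expA hμ (continuous_id (X := EuclideanSpace ℝ (Fin d))) z
  have h4 := (ContinuousLinearMap.smulRightL ℝ (EuclideanSpace ℝ (Fin d))
    (EuclideanSpace ℝ (Fin d))).hasFDerivAt_of_bilinear h2 h3
  have h5 := h1.sub h4
  have e : fderiv ℝ (fun w => gammaAttn w μ) = _ := fderiv_gammaAttn hμ
  rw [e]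
  refine ⟨h5.differentiableAt, fun h0 => h5.fderiv.trans ?_⟩
  have h6 : expA μ (fun y => y) z = 0 := h0
  have h7 : expA μ (fun y => innerSL ℝ y) z = 0 := by rw [expA_innerSL hμ, h6, map_zero]
  have h6' : expA μ id z = 0 := h0
  rw [h7, h6']
  ext u v
  simp
  rfl

theorem gammaAttn_shift (hμ : ∀ᵐ y ∂μ, ‖y‖ ≤ R) (m z : EuclideanSpace ℝ (Fin d)) :
    gammaAttn z μ = m + gammaAttn z (μ.map (fun y => y - m)) := by
  have hm : Measurable (fun y : EuclideanSpace ℝ (Fin d) => y - m) := by fun_prop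
  have hp := gamma2_pos hμ z
  have hi : Integrable (fun y => Real.exp ⟪z, y⟫) μ := by
    simpa using expIntegrable hμ (φ := fun _ => (1 : ℝ)) continuous_const z
  have e1 : gamma2 z (μ.map (fun y => y - m)) = Real.exp (-⟪z, m⟫) * gamma2 z μ := by
    unfold gamma2
    rw [integral_map hm.aemeasurable (by fun_prop), ← integral_const_mul]
    congr 1
    funext y
    rw [← Real.exp_add, inner_sub_right]
    ring_nf
  have e2 : ∫ y, Real.exp ⟪z, y⟫ • y ∂(μ.map (fun y => y - m)) =
      Real.exp (-⟪z, m⟫) • ((∫ y, Real.exp ⟪z, y⟫ • y ∂μ) - gamma2 z μ • m) := by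
    rw [integral_map hm.aemeasurable (by fun_prop), gamma2, ← integral_smul_const,
      ← integral_sub (expIntegrable hμ (φ := fun y => y) continuous_id z) (hi.smul_const m),
      ← integral_smul]
    congr 1
    funext y
    rw [← smul_sub, smul_smul, ← Real.exp_add, inner_sub_right]
    ring_nf
  unfold gammaAttn
  rw [e1, e2, smul_smul, mul_inv, mul_right_comm, inv_mul_cancel₀ (Real.exp_pos _).ne', one_mul,
    smul_sub, smul_smul, inv_mul_cancel₀ hp.ne', one_smul]
  abel

theorem norm_second_le (hμ : ∀ᵐ y ∂μ, ‖y‖ ≤ R) (hR : 0 < R) (z : EuclideanSpace ℝ (Fin d)) :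
    ‖fderiv ℝ (fderiv ℝ (fun w => gammaAttn w μ)) z‖ ≤ 8 * R ^ 3 := by
  obtain ⟨m, hm⟩ : ∃ m, m = gammaAttn z μ := ⟨_, rfl⟩
  have hmR : ‖m‖ ≤ R := by
    rw [hm]
    exact norm_expA_le hμ (φ := fun y => y) hμ z
  have hmeas : Measurable (fun y : EuclideanSpace ℝ (Fin d) => y - m) := by fun_prop
  have : IsProbabilityMeasure (μ.map (fun y => y - m)) :=
    Measure.isProbabilityMeasure_map hmeas.aemeasurable
  have hν : ∀ᵐ y ∂(μ.map (fun y => y - m)), ‖y‖ ≤ 2 * R := by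
    rw [ae_map_iff hmeas.aemeasurable (measurableSet_le (by fun_prop) (by fun_prop))]
    filter_upwards [hμ] with y hy
    have := norm_sub_le y m
    linarith
  have e : fderiv ℝ (fun w => gammaAttn w μ) =
      fderiv ℝ (fun w => gammaAttn w (μ.map (fun y => y - m))) := by
    have : (fun w => gammaAttn w μ) =
      fun w => m + gammaAttn w (μ.map (fun y => y - m)) := funext (gammaAttn_shift hμ m)
    rw [this]
    funext w
    exact fderiv_const_add m
  have h0 : gammaAttn z (μ.map (fun y => y - m)) = 0 := by
    have := gammaAttn_shift hμ m z
    rw [← hm] at this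
    simpa using this
  rw [e, (hasFDerivAt_fderiv_gammaAttn hν z).2 h0]
  refine norm_expA_le hν ?_ z
  filter_upwards [hν] with y hy
  rw [norm_dPhi, norm_dPhi]
  calc ‖y‖ * (‖y‖ * ‖y‖) ≤ (2 * R) * ((2 * R) * (2 * R)) := by gcongr
    _ = 8 * R ^ 3 := by ring

end second

/-- If `μ` is a probability measure supported in `B̄(R₁)`, then `z ↦ γ(z,μ)` is twice Fréchet
differentiable everywhere, the second derivative (as a bilinear map) is bounded by `8R₁³`,
and consequently `z ↦ D_zγ(z,μ)` is `8R₁³`-Lipschitz in the operator norm. -/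
theorem stmt_6 {d : ℕ} (R₁ : ℝ) (hR₁ : 0 < R₁)
    (μ : Measure (EuclideanSpace ℝ (Fin d))) [IsProbabilityMeasure μ]
    (hsupp : μ (Metric.closedBall 0 R₁) = 1) :
    (∀ z, DifferentiableAt ℝ (fun w => gammaAttn w μ) z) ∧
      (∀ z, DifferentiableAt ℝ (fderiv ℝ (fun w => gammaAttn w μ)) z ∧
        ∀ u v : EuclideanSpace ℝ (Fin d),
          ‖fderiv ℝ (fderiv ℝ (fun w => gammaAttn w μ)) z u v‖ ≤ 8 * R₁ ^ 3 * ‖u‖ * ‖v‖) ∧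
      LipschitzWith (Real.toNNReal (8 * R₁ ^ 3)) (fderiv ℝ (fun w => gammaAttn w μ)) := by
  have hμ : ∀ᵐ y ∂μ, ‖y‖ ≤ R₁ := by
    have := (prob_compl_eq_zero_iff (μ := μ)
      (Metric.isClosed_closedBall (x := (0 : EuclideanSpace ℝ (Fin d))) (ε := R₁)).measurableSet).2 hsupp
    have h2 : ∀ᵐ y ∂μ, y ∈ Metric.closedBall (0 : EuclideanSpace ℝ (Fin d)) R₁ := this
    filter_upwards [h2] with y hy
    simpa using hy
  refine ⟨fun z => (hasFDerivAt_expA hμ continuous_id z).differentiableAt, fun z =>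
    ⟨(hasFDerivAt_fderiv_gammaAttn hμ z).1, fun u v => ?_⟩, ?_⟩
  · refine (ContinuousLinearMap.le_opNorm₂ _ u v).trans ?_
    gcongr
    exact norm_second_le hμ hR₁ z
  · refine lipschitzWith_of_nnnorm_fderiv_le
      (fun z => (hasFDerivAt_fderiv_gammaAttn hμ z).1) fun z => ?_
    rw [← NNReal.coe_le_coe, Real.coe_toNNReal _ (by positivity)]
    exact norm_second_le hμ hR₁ z
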